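/- Proposition 4, real case: if λ_∞ ∈ ℝ (so λ_∞ ∈ ℝ \ [t_3,t_4] with b_0² ∫ dμ(t)/(t−λ_∞)² < 1), then λ_n ∈ ℝ for all sufficiently large n. -/

import Mathlib

open MeasureTheory Complex Filter

/-- The (n+1)×(n+1) truncation H_{[0,n]} of the non-symmetric Jacobi matrix. -/
noncomputable def JacobiH0 (a b : ℕ → ℝ) (n : ℕ) : Matrix (Fin (n + 1)) (Fin (n + 1)) ℂ :=
  Matrix.of fun i j =>
    if (i : ℕ) = (j : ℕ) then (a i : ℂ)
    else if (i : ℕ) + 1 = (j : ℕ) then (if (i : ℕ) = 0 then -(b 0 : ℂ) else (b (i : ℕ) : ℂ))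
    else if (j : ℕ) + 1 = (i : ℕ) then (b (j : ℕ) : ℂ)
    else 0

/-- The n×n truncation H_{[1,n]} of the symmetric Jacobi matrix (entries shifted by one). -/
noncomputable def JacobiH1 (a b : ℕ → ℝ) (n : ℕ) : Matrix (Fin n) (Fin n) ℂ :=
  Matrix.of fun i j =>
    if (i : ℕ) = (j : ℕ) then (a ((i : ℕ) + 1) : ℂ)
    else if (i : ℕ) + 1 = (j : ℕ) then (b ((i : ℕ) + 1) : ℂ)
    else if (j : ℕ) + 1 = (i : ℕ) then (b ((j : ℕ) + 1) : ℂ)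
    else 0

/-- `lam` is an eigenvalue of nonpositive type of H_{[0,n]}. -/
def IsNPTev (a b : ℕ → ℝ) (n : ℕ) (lam : ℂ) : Prop :=
  0 ≤ lam.im ∧ ∃ f : Fin (n + 1) → ℂ, f ≠ 0 ∧ (JacobiH0 a b n).mulVec f = lam • f ∧
    -‖f 0‖ ^ 2 + ∑ j : Fin n, ‖f j.succ‖ ^ 2 ≤ 0

/-- Cauchy transform of a Borel measure on ℝ. -/
noncomputable def cauchyT (σ : Measure ℝ) (z : ℂ) : ℂ := ∫ t, ((t : ℂ) - z)⁻¹ ∂σ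

/-- Topological support of a Borel measure on ℝ. -/
def msupport (σ : Measure ℝ) : Set ℝ := {x | ∀ U ∈ nhds x, σ U ≠ 0}

/-- The (0,0) entry of the resolvent of the truncation H_{[1,n]}, i.e. the truncated
m-function m_{[1,n]}(z) (with the zero value convention for non-invertible matrices,
and the value 0 for the empty truncation). -/
noncomputable def jacobiM1 (a b : ℕ → ℝ) (n : ℕ) (z : ℂ) : ℂ :=
  if h : 0 < n then ((JacobiH1 a b n - z • 1)⁻¹) ⟨0, h⟩ ⟨0, h⟩ else 0

/-- Let `(1, g)` be an eigenvector of the bordered operator built from the symmetric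
operator `A`, with eigenvalue `l`. If `u` approximates `(A - x)⁻¹ e`, `b ‖u‖ < 1`, and `A - x` is
bounded below, then `l` is not in the open upper half-plane. -/
theorem im_nonpos_of_approx_resolvent {E : Type*} [NormedAddCommGroup E] [InnerProductSpace ℂ E]
    {A : E →ₗ[ℂ] E} (hA : A.IsSymmetric) {e u g : E} {x a b d s δ c Q : ℝ} {l : ℂ}
    (hb : 0 < b) (hd : 0 < d) (hs : s < 1)
    (hAg : A g - l • g = -((b : ℂ) • e)) (heg : (b : ℂ) * inner ℂ e g = a - l)
    (hr : ‖A u - (x : ℂ) • u - e‖ ≤ δ) (hQ : inner ℂ u e = (Q : ℂ)) (hc : x - a = b ^ 2 * c)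
    (hcQ : |c - Q| ≤ δ) (hu : b * ‖u‖ ≤ s)
    (hlow : ∀ v, d * ‖v‖ ≤ ‖A v - (x : ℂ) • v‖)
    (hδ : ((b ^ 2 + b) / (1 - s) + b) * δ < (1 - s) * d) : l.im ≤ 0 := by
  by_contra! hl
  have hgg : ‖g‖ = 1 := by
    have h1 : inner ℂ g (A g) = l * (‖g‖ : ℂ) ^ 2 - b * inner ℂ g e := by
      have : A g = l • g - (b : ℂ) • e := by
        rw [sub_eq_iff_eq_add] at hAg; rw [hAg]; abel
      rw [this, inner_sub_right, inner_smul_right, inner_smul_right, inner_self_eq_norm_sq_to_K]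
      rfl
    have h2 : (inner ℂ g (A g)).im = 0 := hA.im_inner_self_apply g
    have h3 : (b : ℂ) * inner ℂ g e = a - starRingEnd ℂ l := by
      rw [← inner_conj_symm]
      have := congrArg (starRingEnd ℂ) heg
      simpa using this
    rw [h1, h3] at h2
    have h4 : l.im * (‖g‖ ^ 2 - 1) = 0 := by
      have : (l * (‖g‖ : ℂ) ^ 2 - (a - starRingEnd ℂ l)).im = l.im * (‖g‖ ^ 2 - 1) := by
        rw [← Complex.ofReal_pow]
        simp only [sub_im, mul_im, ofReal_re, ofReal_im, conj_im]
        ring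
      rw [← this, h2]
    have h5 : ‖g‖ ^ 2 = 1 := by
      rcases mul_eq_zero.mp h4 with h | h
      · exact absurd h hl.ne'
      · linarith
    exact (pow_eq_one_iff_of_nonneg (norm_nonneg g) two_ne_zero).mp h5
  set r := A u - (x : ℂ) • u - e with hrdef
  have key : (l - x) * (1 + b * inner ℂ u g) = b * inner ℂ r g - b ^ 2 * (c - Q) := by
    have h1 : inner ℂ u (A g - l • g) = -((b : ℂ) * Q) := by
      rw [hAg, inner_neg_right, inner_smul_right, hQ]
    have h2 : inner ℂ r g = inner ℂ u (A g) - x * inner ℂ u g - inner ℂ e g := by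
      rw [hrdef, inner_sub_left, inner_sub_left, inner_smul_left, hA u g]
      simp
    rw [inner_sub_right, inner_smul_right] at h1
    have hc' : (x : ℂ) - a = b ^ 2 * c := by exact_mod_cast hc
    rw [h2]
    linear_combination (-(b : ℂ)) * h1 + heg - hc'
  have hlx : ‖l - x‖ * (1 - s) ≤ (b ^ 2 + b) * δ := by
    have h1 : 1 - s ≤ ‖1 + (b : ℂ) * inner ℂ u g‖ := by
      have h2 : ‖(b : ℂ) * inner ℂ u g‖ ≤ s := by
        rw [norm_mul, Complex.norm_real, Real.norm_of_nonneg hb.le]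
        refine le_trans ?_ hu
        have := norm_inner_le_norm (𝕜 := ℂ) u g
        rw [hgg, mul_one] at this
        gcongr
      have h3 := norm_sub_le (1 + (b : ℂ) * inner ℂ u g) ((b : ℂ) * inner ℂ u g)
      rw [add_sub_cancel_right, norm_one] at h3
      linarith
    calc ‖l - x‖ * (1 - s) ≤ ‖l - x‖ * ‖1 + (b : ℂ) * inner ℂ u g‖ := by gcongr
      _ = ‖(b : ℂ) * inner ℂ r g - b ^ 2 * (c - Q)‖ := by rw [← norm_mul, key]
      _ ≤ ‖(b : ℂ) * inner ℂ r g‖ + ‖(b : ℂ) ^ 2 * (c - Q)‖ := norm_sub_le _ _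
      _ ≤ b * δ + b ^ 2 * δ := by
        have h4 := norm_inner_le_norm (𝕜 := ℂ) r g
        rw [hgg, mul_one] at h4
        have h5 : ‖(c : ℂ) - Q‖ ≤ δ := by
          rw [← Complex.ofReal_sub, Complex.norm_real]; exact hcQ
        rw [norm_mul, norm_mul, norm_pow, Complex.norm_real, Real.norm_of_nonneg hb.le]
        gcongr
        exact h4.trans hr
      _ = _ := by ring
  have hs' : 0 < 1 - s := by linarith
  have hv : d * ‖g + (b : ℂ) • u‖ ≤ ‖l - x‖ + b * δ := by
    refine (hlow _).trans ?_
    have : A (g + (b : ℂ) • u) - (x : ℂ) • (g + (b : ℂ) • u) = (l - x) • g + (b : ℂ) • r := by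
      have h1 : A g = l • g - (b : ℂ) • e := by
        rw [sub_eq_iff_eq_add] at hAg; rw [hAg]; abel
      rw [map_add, map_smul, h1, hrdef]
      module
    rw [this]
    refine (norm_add_le _ _).trans ?_
    rw [norm_smul, norm_smul, hgg, mul_one, Complex.norm_real, Real.norm_of_nonneg hb.le]
    gcongr
  have h1 : 1 ≤ ‖g + (b : ℂ) • u‖ + s := by
    have := norm_sub_le (g + (b : ℂ) • u) ((b : ℂ) • u)
    rw [add_sub_cancel_right, hgg, norm_smul, Complex.norm_real, Real.norm_of_nonneg hb.le] at this
    linarith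
  have h2 : ‖l - x‖ ≤ (b ^ 2 + b) / (1 - s) * δ := by
    rw [div_mul_eq_mul_div, le_div_iff₀ hs']; exact hlx
  nlinarith

open Polynomial in
theorem LinearMap.IsSymmetric.aeval_real {E : Type*} [NormedAddCommGroup E]
    [InnerProductSpace ℂ E] {A : Module.End ℂ E} (hA : LinearMap.IsSymmetric A) (p : ℝ[X]) :
    LinearMap.IsSymmetric (aeval A p) := by
  induction p using Polynomial.induction_on' with
  | add p q hp hq => rw [map_add]; exact hp.add hq
  | monomial n c =>
    intro v w
    have := hA.pow n v w
    rw [aeval_monomial]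
    simp only [Module.End.mul_apply, Module.algebraMap_end_apply, inner_smul_left_eq_smul,
      inner_smul_right_eq_smul, this]

section moments

variable {μ : Measure ℝ} [IsProbabilityMeasure μ] {t3 t4 : ℝ}

theorem integrable_of_continuousOn_ae_Icc {f : ℝ → ℝ} (hμ : ∀ᵐ t ∂μ, t ∈ Set.Icc t3 t4)
    (hf : ContinuousOn f (Set.Icc t3 t4)) : Integrable f μ := by
  rw [← Measure.restrict_eq_self_of_ae_mem hμ]
  exact hf.integrableOn_compact isCompact_Icc

variable {E : Type*} [NormedAddCommGroup E] [InnerProductSpace ℂ E] {A : Module.End ℂ E} {e : E}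
  {K : ℕ}

open Polynomial in
theorem inner_aeval_eq_integral (hμ : ∀ᵐ t ∂μ, t ∈ Set.Icc t3 t4)
    (hmom : ∀ k ≤ K, inner ℂ e ((A ^ k) e) = ((∫ t, t ^ k ∂μ : ℝ) : ℂ)) (p : ℝ[X])
    (hp : p.natDegree ≤ K) : inner ℂ e (aeval A p e) = ((∫ t, p.eval t ∂μ : ℝ) : ℂ) := by
  simp only [eval_eq_sum_range' (Nat.lt_succ_of_le hp)]
  rw [aeval_eq_sum_range' (Nat.lt_succ_of_le hp), integral_finsetSum _ fun i _ =>
    integrable_of_continuousOn_ae_Icc hμ (by fun_prop), LinearMap.sum_apply, inner_sum]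
  push_cast
  refine Finset.sum_congr rfl fun i hi => ?_
  rw [LinearMap.smul_apply, inner_smul_right_eq_smul, hmom i (by simpa using hi),
    integral_const_mul]
  simp

open Polynomial in
theorem inner_aeval_aeval_eq_integral (hA : LinearMap.IsSymmetric A)
    (hμ : ∀ᵐ t ∂μ, t ∈ Set.Icc t3 t4)
    (hmom : ∀ k ≤ K, inner ℂ e ((A ^ k) e) = ((∫ t, t ^ k ∂μ : ℝ) : ℂ)) (p q : ℝ[X])
    (hpq : p.natDegree + q.natDegree ≤ K) :
    inner ℂ (aeval A p e) (aeval A q e) = ((∫ t, p.eval t * q.eval t ∂μ : ℝ) : ℂ) := by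
  rw [hA.aeval_real p, ← Module.End.mul_apply, ← map_mul,
    inner_aeval_eq_integral hμ hmom _ (natDegree_mul_le.trans hpq)]
  simp

open Polynomial in
theorem norm_sq_aeval_eq_integral (hA : LinearMap.IsSymmetric A)
    (hμ : ∀ᵐ t ∂μ, t ∈ Set.Icc t3 t4)
    (hmom : ∀ k ≤ K, inner ℂ e ((A ^ k) e) = ((∫ t, t ^ k ∂μ : ℝ) : ℂ)) (p : ℝ[X])
    (hp : 2 * p.natDegree ≤ K) : ‖aeval A p e‖ ^ 2 = ∫ t, p.eval t ^ 2 ∂μ := by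
  have := inner_aeval_aeval_eq_integral hA hμ hmom p p (by omega)
  rw [inner_self_eq_norm_sq_to_K] at this
  simp only [pow_two] at this ⊢
  exact Complex.ofReal_injective (by simpa using this)

open Polynomial in
theorem mul_norm_le_norm_sub_of_cyclic (hA : LinearMap.IsSymmetric A)
    (hμ : ∀ᵐ t ∂μ, t ∈ Set.Icc t3 t4) {m : ℕ} (hK : 2 * m + 1 ≤ K)
    (hmom : ∀ k ≤ K, inner ℂ e ((A ^ k) e) = ((∫ t, t ^ k ∂μ : ℝ) : ℂ))
    (hcyc : ∀ v : E, ∃ p q : ℝ[X], p.natDegree ≤ m ∧ q.natDegree ≤ m ∧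
      v = aeval A p e + I • aeval A q e) {σ x d : ℝ} (hσ : |σ| = 1)
    (hd : ∀ t ∈ Set.Icc t3 t4, d ≤ σ * (t - x)) (v : E) :
    d * ‖v‖ ≤ ‖A v - (x : ℂ) • v‖ := by
  have hform : ∀ v : E, 0 ≤ (inner ℂ v (aeval A (C σ * (X - C x) - C d) v)).re := by
    intro v
    obtain ⟨p, q, hp, hq, rfl⟩ := hcyc v
    set B : ℝ[X] := C σ * (X - C x) - C d with hB
    have hBdeg : B.natDegree ≤ 1 := by rw [hB]; compute_degree
    have h1 : ∀ r s : ℝ[X], r.natDegree ≤ m → s.natDegree ≤ m →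
        inner ℂ (aeval A r e) (aeval A B (aeval A s e))
          = ((∫ t, r.eval t * (B.eval t * s.eval t) ∂μ : ℝ) : ℂ) := by
      intro r s hr hs
      rw [← Module.End.mul_apply, ← map_mul, inner_aeval_aeval_eq_integral hA hμ hmom]
      · simp
      · have := natDegree_mul_le (p := B) (q := s)
        omega
    have h2 : ∀ r : ℝ[X], 0 ≤ ∫ t, r.eval t * (B.eval t * r.eval t) ∂μ := by
      intro r
      refine integral_nonneg_of_ae ?_
      filter_upwards [hμ] with t ht
      have : 0 ≤ B.eval t := by
        have := hd t ht
        simp only [hB, eval_sub, eval_mul, eval_C, eval_X]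
        linarith
      have h3 : r.eval t * (B.eval t * r.eval t) = B.eval t * (r.eval t) ^ 2 := by ring
      rw [h3]
      exact mul_nonneg this (sq_nonneg _)
    rw [map_add, map_smul, inner_add_left, inner_add_right, inner_add_right, inner_smul_left,
      inner_smul_right, inner_smul_left, inner_smul_right, h1 p p hp hp, h1 p q hp hq,
      h1 q p hq hp, h1 q q hq hq]
    have := h2 p
    have := h2 q
    simp
    positivity
  have h1 := hform v
  have h2 : aeval A (C σ * (X - C x) - C d) v
      = (σ : ℂ) • (A v - (x : ℂ) • v) - (d : ℂ) • v := by
    simp [Module.algebraMap_end_apply]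
  rw [h2, inner_sub_right, inner_smul_right, inner_smul_right, inner_self_eq_norm_sq_to_K,
    Complex.sub_re] at h1
  have h3 : ((d : ℂ) * ((‖v‖ : ℂ)) ^ 2).re = d * ‖v‖ ^ 2 := by
    rw [← Complex.ofReal_pow, ← Complex.ofReal_mul, Complex.ofReal_re]
  have h4 : ((σ : ℂ) * inner ℂ v (A v - (x : ℂ) • v)).re ≤ ‖v‖ * ‖A v - (x : ℂ) • v‖ := by
    refine (Complex.re_le_norm _).trans ?_
    rw [norm_mul, Complex.norm_real, Real.norm_eq_abs, hσ, one_mul]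
    exact norm_inner_le_norm _ _
  rcases (norm_nonneg v).eq_or_lt with h | h
  · rw [← h]; simp
  · have h5 : d * ‖v‖ ^ 2 ≤ ‖v‖ * ‖A v - (x : ℂ) • v‖ := by
      have h6 : ((d : ℂ) * ((‖v‖ : ℂ)) ^ 2).re ≤ ((σ : ℂ) * inner ℂ v (A v - (x : ℂ) • v)).re :=
        sub_nonneg.mp h1
      linarith
    nlinarith

end moments

theorem isHermitian_jacobiH1 (a b : ℕ → ℝ) (n : ℕ) : (JacobiH1 a b n).IsHermitian := by
  ext i j
  simp only [Matrix.conjTranspose_apply, JacobiH1, Matrix.of_apply]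
  by_cases h1 : (i : ℕ) = j
  · simp [h1]
  · by_cases h2 : (i : ℕ) + 1 = j
    · have h3 : ¬ (j : ℕ) + 1 = i := by omega
      simp [h1, Ne.symm h1, h2, h3]
    · by_cases h3 : (j : ℕ) + 1 = i
      · simp [h1, Ne.symm h1, h2, h3]
      · simp [h1, Ne.symm h1, h2, h3]

theorem toEuclideanLin_pow_single {n : ℕ} (M : Matrix (Fin n) (Fin n) ℂ) (j : Fin n) (k : ℕ) :
    ((Matrix.toEuclideanLin M : Module.End ℂ (EuclideanSpace ℂ (Fin n))) ^ k)
      (EuclideanSpace.single j 1) = WithLp.toLp 2 ((M ^ k).col j) := by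
  induction k with
  | zero => ext i; simp [Matrix.one_apply]
  | succ k ih =>
    rw [pow_succ', Module.End.mul_apply, ih]
    ext i
    simp [Matrix.toLpLin_apply, pow_succ', Matrix.mul_apply, Matrix.mulVec, dotProduct]

theorem toEuclideanLin_single_apply {n : ℕ} (M : Matrix (Fin n) (Fin n) ℂ) (i j : Fin n) :
    Matrix.toEuclideanLin M (EuclideanSpace.single j 1) i = M i j := by
  simp [Matrix.toLpLin_apply]

open Polynomial in
theorem exists_aeval_jacobiH1_single (a b : ℕ → ℝ) (hb : ∀ j, 0 < b j) (m : ℕ) (j : ℕ)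
    (hj : j < m + 1) : ∃ p : ℝ[X], p.natDegree ≤ j ∧
      aeval (Matrix.toEuclideanLin (JacobiH1 a b (m + 1)) :
        Module.End ℂ (EuclideanSpace ℂ (Fin (m + 1)))) p (EuclideanSpace.single 0 1)
      = EuclideanSpace.single ⟨j, hj⟩ 1 := by
  induction j using Nat.strong_induction_on with
  | _ j ih =>
    rcases j with _ | _ | j
    · exact ⟨1, by simp, by simp⟩
    · refine ⟨C (b 1)⁻¹ * (X - C (a 1)), by compute_degree, ?_⟩
      have hb1 : (b 1 : ℂ) ≠ 0 := by exact_mod_cast (hb 1).ne'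
      ext i
      simp only [map_mul, map_sub, aeval_C, aeval_X, Module.End.mul_apply,
        Module.algebraMap_end_apply, LinearMap.sub_apply, PiLp.smul_apply, PiLp.sub_apply,
        toEuclideanLin_single_apply, PiLp.single_apply, JacobiH1, Matrix.of_apply, Fin.ext_iff,
        Fin.val_zero, Complex.real_smul, ofReal_inv]
      rcases i with ⟨_ | _ | i, hi⟩ <;> simp [hb1]
    · obtain ⟨p, hp, hp'⟩ := ih j (by omega) (by omega)
      obtain ⟨q, hq, hq'⟩ := ih (j + 1) (by omega) (by omega)
      refine ⟨C (b (j + 2))⁻¹ * ((X - C (a (j + 2))) * q - C (b (j + 1)) * p), ?_, ?_⟩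
      · have h1 : ((X - C (a (j + 2))) * q).natDegree ≤ j + 1 + 1 := by
          refine natDegree_mul_le.trans ?_
          have : (X - C (a (j + 2))).natDegree ≤ 1 := by compute_degree
          omega
        have h2 : (C (b (j + 1)) * p).natDegree ≤ j + 1 + 1 :=
          (natDegree_C_mul_le _ _).trans (by omega)
        exact (natDegree_C_mul_le _ _).trans ((natDegree_sub_le_of_le h1 h2).trans (max_self _).le)
      · have hb2 : (b (j + 2) : ℂ) ≠ 0 := by exact_mod_cast (hb (j + 2)).ne'
        simp only [map_mul, map_sub, aeval_C, aeval_X, Module.End.mul_apply,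
          Module.algebraMap_end_apply, LinearMap.sub_apply, hp', hq']
        ext i
        simp only [PiLp.smul_apply, PiLp.sub_apply, toEuclideanLin_single_apply,
          PiLp.single_apply, JacobiH1, Matrix.of_apply, Fin.ext_iff, Complex.real_smul,
          ofReal_inv]
        rcases i with ⟨i, hi⟩
        obtain h | h | h | h | h : i < j ∨ i = j ∨ i = j + 1 ∨ i = j + 2 ∨ j + 2 < i := by omega
        · have h1 : i ≠ j + 1 := by omega
          have h2 : i ≠ j + 1 + 1 := by omega
          have h3 : j + 1 + 1 ≠ i := by omega
          simp [h.ne, h1, h2, h3]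
        · have h2 : j ≠ j + 1 + 1 := by omega
          simp [h, h2]
        · simp [h]
        · simp [h, hb2]
        · have h1 : i ≠ j + 1 := by omega
          have h2 : i ≠ j + 1 + 1 := by omega
          have h3 : j + 1 + 1 ≠ i := by omega
          have h4 : i ≠ j := by omega
          simp [h1, h2, h3, h4]

open Polynomial in
theorem exists_aeval_jacobiH1 (a b : ℕ → ℝ) (hb : ∀ j, 0 < b j) (m : ℕ)
    (v : EuclideanSpace ℂ (Fin (m + 1))) : ∃ p q : ℝ[X], p.natDegree ≤ m ∧ q.natDegree ≤ m ∧
      v = aeval (Matrix.toEuclideanLin (JacobiH1 a b (m + 1)) :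
          Module.End ℂ (EuclideanSpace ℂ (Fin (m + 1)))) p (EuclideanSpace.single 0 1)
        + I • aeval (Matrix.toEuclideanLin (JacobiH1 a b (m + 1)) :
          Module.End ℂ (EuclideanSpace ℂ (Fin (m + 1)))) q (EuclideanSpace.single 0 1) := by
  choose P hP hP' using fun j : Fin (m + 1) => exists_aeval_jacobiH1_single a b hb m j j.2
  have hdeg : ∀ c : Fin (m + 1) → ℝ, (∑ j, C (c j) * P j).natDegree ≤ m := fun c =>
    natDegree_sum_le_of_forall_le _ _ fun j _ =>
      (natDegree_C_mul_le _ _).trans ((hP j).trans (by omega))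
  refine ⟨∑ j, C (v j).re * P j, ∑ j, C (v j).im * P j, hdeg _, hdeg _, ?_⟩
  simp only [map_sum, map_mul, aeval_C, LinearMap.sum_apply, Module.End.mul_apply, hP',
    Module.algebraMap_end_apply]
  ext i
  simp only [PiLp.add_apply, PiLp.smul_apply, WithLp.ofLp_sum, Finset.sum_apply,
    PiLp.single_apply, smul_eq_mul, Complex.real_smul, mul_ite, mul_one, mul_zero, Fin.eta,
    Finset.sum_ite_eq, Finset.mem_univ, if_true]
  rw [mul_comm, Complex.re_add_im]

theorem IsNPTev.exists_resolvent_vector {a b : ℕ → ℝ} {m : ℕ} {l : ℂ}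
    (h : IsNPTev a b (m + 1) l) : ∃ g : EuclideanSpace ℂ (Fin (m + 1)),
      Matrix.toEuclideanLin (JacobiH1 a b (m + 1)) g - l • g
        = -((b 0 : ℂ) • EuclideanSpace.single 0 1) ∧
      (b 0 : ℂ) * inner ℂ (EuclideanSpace.single 0 1) g = a 0 - l := by
  obtain ⟨-, f, hf, hev, hnp⟩ := h
  have hf0 : f 0 ≠ 0 := by
    intro h0
    refine hf (funext fun j => ?_)
    refine Fin.cases h0 (fun j => ?_) j
    have hsum : ∑ j : Fin (m + 1), ‖f j.succ‖ ^ 2 ≤ 0 := by simpa [h0] using hnp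
    have h1 := (Finset.single_le_sum (f := fun j : Fin (m + 1) => ‖f j.succ‖ ^ 2)
      (fun i _ => sq_nonneg _) (Finset.mem_univ j)).trans hsum
    exact norm_eq_zero.mp (pow_eq_zero_iff two_ne_zero |>.mp (le_antisymm h1 (sq_nonneg _)))
  have hrow0 := congrFun hev 0
  have hrow := fun i : Fin (m + 1) => congrFun hev i.succ
  simp only [Matrix.mulVec, dotProduct, Fin.sum_univ_succ (n := m + 1), Pi.smul_apply,
    smul_eq_mul] at hrow0 hrow
  have e1 : ∀ i j : Fin (m + 1),
      JacobiH0 a b (m + 1) i.succ j.succ = JacobiH1 a b (m + 1) i j := by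
    intro i j
    simp [JacobiH0, JacobiH1]
  have e2 : ∀ i : Fin (m + 1), JacobiH0 a b (m + 1) i.succ 0 = if i = 0 then (b 0 : ℂ) else 0 := by
    intro i
    simp [JacobiH0]
  have e3 : ∀ j : Fin (m + 1),
      JacobiH0 a b (m + 1) 0 j.succ = if j = 0 then -(b 0 : ℂ) else 0 := by
    intro j
    simp [JacobiH0]
  have e4 : JacobiH0 a b (m + 1) 0 0 = a 0 := by simp [JacobiH0]
  simp only [e1, e2] at hrow
  simp only [e3, e4, ite_mul, zero_mul, Finset.sum_ite_eq', Finset.mem_univ, if_true] at hrow0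
  refine ⟨WithLp.toLp 2 fun j => (f 0)⁻¹ * f j.succ, ?_, ?_⟩
  · ext i
    have h1 := hrow i
    simp only [PiLp.sub_apply, PiLp.smul_apply, PiLp.neg_apply, Matrix.toLpLin_apply,
      Matrix.mulVec, dotProduct, PiLp.single_apply, smul_eq_mul]
    have h2 : ∑ j, JacobiH1 a b (m + 1) i j * ((f 0)⁻¹ * f j.succ)
        = (f 0)⁻¹ * ∑ j, JacobiH1 a b (m + 1) i j * f j.succ := by
      rw [Finset.mul_sum]
      exact Finset.sum_congr rfl fun j _ => by ring
    rw [h2]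
    split_ifs at h1 ⊢ <;> field_simp <;> linear_combination h1
  · rw [EuclideanSpace.inner_single_left]
    simp only [map_one, one_mul]
    field_simp
    linear_combination -hrow0

theorem ae_mem_of_msupport_subset {μ : Measure ℝ} {s : Set ℝ} (h : msupport μ ⊆ s) :
    ∀ᵐ t ∂μ, t ∈ s := by
  refine measure_null_of_locally_null _ fun t ht => ?_
  by_contra! hcon
  exact ht (h fun U hU => hcon U (mem_nhdsWithin_of_mem_nhds hU))

open Polynomial in
/-- The Cauchy kernel at a real point `x` off `[t3, t4]` is approximated on `[t3, t4]` by
polynomials, with control of the relevant moments of `μ`. -/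
theorem exists_polynomial_approx_inv_sub {μ : Measure ℝ} [IsProbabilityMeasure μ]
    {t3 t4 x d σ η D : ℝ} (hμ : ∀ᵐ t ∂μ, t ∈ Set.Icc t3 t4) (hσ : |σ| = 1) (hd0 : 0 < d)
    (hd : ∀ t ∈ Set.Icc t3 t4, d ≤ σ * (t - x)) (hD : ∀ t ∈ Set.Icc t3 t4, |t - x| ≤ D)
    (hη : 0 < η) : ∃ q : ℝ[X],
      |∫ t, (t - x)⁻¹ ∂μ - ∫ t, q.eval t ∂μ| ≤ η ∧
      ∫ t, q.eval t ^ 2 ∂μ ≤ ∫ t, ((t - x) ^ 2)⁻¹ ∂μ + η * (2 / d + η) ∧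
      ∫ t, ((X - C x) * q - 1).eval t ^ 2 ∂μ ≤ (D * η) ^ 2 := by
  have habs : ∀ t ∈ Set.Icc t3 t4, d ≤ |t - x| := fun t ht => by
    have := (hd t ht).trans (le_abs_self _)
    rwa [abs_mul, hσ, one_mul] at this
  have hne : ∀ t ∈ Set.Icc t3 t4, t - x ≠ 0 := fun t ht =>
    abs_pos.mp (hd0.trans_le (habs t ht))
  have hw : ContinuousOn (fun t => (t - x)⁻¹) (Set.Icc t3 t4) :=
    ContinuousOn.inv₀ (by fun_prop) hne
  have hw2 : ContinuousOn (fun t => ((t - x) ^ 2)⁻¹) (Set.Icc t3 t4) :=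
    ContinuousOn.inv₀ (by fun_prop) fun t ht => pow_ne_zero 2 (hne t ht)
  obtain ⟨q, hq⟩ := exists_polynomial_near_of_continuousOn t3 t4 _ hw η hη
  have hint : ∀ p : ℝ[X], Integrable (fun t => p.eval t) μ := fun p =>
    integrable_of_continuousOn_ae_Icc hμ (by fun_prop)
  have hint2 : ∀ p : ℝ[X], Integrable (fun t => p.eval t ^ 2) μ := fun p =>
    integrable_of_continuousOn_ae_Icc hμ (by fun_prop)
  refine ⟨q, ?_, ?_, ?_⟩
  · rw [← integral_sub (integrable_of_continuousOn_ae_Icc hμ hw) (hint q), ← Real.norm_eq_abs]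
    refine (norm_integral_le_of_norm_le_const (C := η) ?_).trans (by simp)
    filter_upwards [hμ] with t ht
    rw [Real.norm_eq_abs, abs_sub_comm]
    exact (hq t ht).le
  · have h1 : ∫ t, ((t - x) ^ 2)⁻¹ ∂μ + η * (2 / d + η)
        = ∫ t, (((t - x) ^ 2)⁻¹ + η * (2 / d + η)) ∂μ := by
      rw [integral_add (integrable_of_continuousOn_ae_Icc hμ hw2) (integrable_const _)]
      simp
    rw [h1]
    refine integral_mono_ae (hint2 q)
      ((integrable_of_continuousOn_ae_Icc hμ hw2).add (integrable_const _)) ?_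
    filter_upwards [hμ] with t ht
    have h2 := (hq t ht).le
    have h3 : |(t - x)⁻¹| ≤ 1 / d := by
      rw [abs_inv, ← one_div]
      exact one_div_le_one_div_of_le hd0 (habs t ht)
    have h4 : |q.eval t| ≤ 1 / d + η := by
      have := abs_add_le ((t - x)⁻¹) (q.eval t - (t - x)⁻¹)
      rw [add_sub_cancel] at this
      linarith
    have h5 : q.eval t ^ 2 - ((t - x)⁻¹) ^ 2 ≤ η * (2 / d + η) := by
      have h6 : q.eval t ^ 2 - ((t - x)⁻¹) ^ 2
          = (q.eval t - (t - x)⁻¹) * (q.eval t + (t - x)⁻¹) := by ring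
      rw [h6]
      refine (le_abs_self _).trans ?_
      rw [abs_mul]
      have h7 : |q.eval t + (t - x)⁻¹| ≤ 2 / d + η := by
        refine (abs_add_le _ _).trans ?_
        have : 2 / d = 1 / d + 1 / d := by ring
        linarith
      gcongr
    rw [inv_pow] at h5
    show q.eval t ^ 2 ≤ ((t - x) ^ 2)⁻¹ + η * (2 / d + η)
    linarith
  · have h1 : (D * η) ^ 2 = ∫ _, (D * η) ^ 2 ∂μ := by simp
    rw [h1]
    refine integral_mono_ae (hint2 _) (integrable_const _) ?_
    filter_upwards [hμ] with t ht
    have h2 : ((X - C x) * q - 1).eval t = (t - x) * (q.eval t - (t - x)⁻¹) := by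
      simp [mul_sub, hne t ht]
    show ((X - C x) * q - 1).eval t ^ 2 ≤ (D * η) ^ 2
    rw [h2, ← sq_abs, abs_mul]
    have h3 := (hq t ht).le
    have h4 := hD t ht
    gcongr
    exact (abs_nonneg _).trans h4

/-- Proposition 4, real case: eventually all the eigenvalues of nonpositive type are real. -/
theorem stmt_10
    (a b : ℕ → ℝ) (hb : ∀ j, 0 < b j) (t3 t4 : ℝ) (ht34 : t3 < t4)
    (μ : Measure ℝ) (hprob : IsProbabilityMeasure μ)
    (hsupp : msupport μ ⊆ Set.Icc t3 t4) (hsuppinf : (msupport μ).Infinite)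
    (hGauss : ∀ N : ℕ, ∀ hN : 1 ≤ N, ∀ k : ℕ, k ≤ 2 * N - 1 →
      ((JacobiH1 a b N ^ k) ⟨0, hN⟩ ⟨0, hN⟩) = ((∫ t, t ^ k ∂μ : ℝ) : ℂ))
    (lam : ℕ → ℂ) (hlam : ∀ n : ℕ, 1 ≤ n → IsNPTev a b n (lam n))
    (lamInf : ℂ)
    (hroot : lamInf - (a 0 : ℂ) - (b 0 : ℂ) ^ 2 * cauchyT μ lamInf = 0)
    (hsimple :
      (0 < lamInf.im ∧ 1 - (b 0 : ℂ) ^ 2 * ∫ t, (((t : ℂ) - lamInf) ^ 2)⁻¹ ∂μ ≠ 0) ∨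
      (lamInf.im = 0 ∧ (lamInf.re < t3 ∨ t4 < lamInf.re) ∧
        (b 0) ^ 2 * ∫ t, ((t - lamInf.re) ^ 2)⁻¹ ∂μ < 1))
    (hreal : lamInf.im = 0) :
    ∃ N : ℕ, ∀ n : ℕ, N ≤ n → (lam n).im = 0 := by
  set x := lamInf.re with hx
  have hlx : lamInf = (x : ℂ) := Complex.ext rfl (by simpa using hreal)
  obtain ⟨-, hout, hS⟩ := hsimple.resolve_left fun h => h.1.ne' hreal
  have hμ := ae_mem_of_msupport_subset hsupp
  have hc : x - a 0 = b 0 ^ 2 * ∫ t, (t - x)⁻¹ ∂μ := by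
    have h1 : cauchyT μ lamInf = ((∫ t, (t - x)⁻¹ ∂μ : ℝ) : ℂ) := by
      rw [cauchyT, hlx, ← integral_complex_ofReal]
      push_cast
      rfl
    rw [h1, hlx] at hroot
    have h2 : x - a 0 - b 0 ^ 2 * ∫ t, (t - x)⁻¹ ∂μ = 0 := by exact_mod_cast hroot
    linarith
  obtain ⟨σ, d, hσ, hd0, hd⟩ : ∃ σ d : ℝ, |σ| = 1 ∧ 0 < d ∧
      ∀ t ∈ Set.Icc t3 t4, d ≤ σ * (t - x) := by
    rcases hout with h | h
    · exact ⟨1, t3 - x, by simp, by linarith, fun t ht => by linarith [ht.1]⟩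
    · exact ⟨-1, x - t4, by simp, by linarith, fun t ht => by linarith [ht.2]⟩
  have hD : ∀ t ∈ Set.Icc t3 t4, |t - x| ≤ |t3 - x| + |t4 - x| := fun t ht => by
    rw [abs_le]
    constructor
    · linarith [neg_abs_le (t3 - x), abs_nonneg (t4 - x), ht.1]
    · linarith [le_abs_self (t4 - x), abs_nonneg (t3 - x), ht.2]
  set D := |t3 - x| + |t4 - x| with hDdef
  have hD0 : 0 ≤ D := by positivity
  set S := b 0 ^ 2 * ∫ t, ((t - x) ^ 2)⁻¹ ∂μ with hSdef
  have hS0 : 0 ≤ S := mul_nonneg (sq_nonneg _) (integral_nonneg fun t => by positivity)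
  obtain ⟨s, hs0, hs1, hSs⟩ : ∃ s : ℝ, 0 < s ∧ s < 1 ∧ S < s ^ 2 := by
    obtain ⟨s, h1, h2⟩ := exists_between ((Real.sqrt_lt' one_pos).mpr (by simpa using hS))
    exact ⟨s, (Real.sqrt_nonneg S).trans_lt h1, h2,
      (Real.sqrt_lt' ((Real.sqrt_nonneg S).trans_lt h1)).mp h1⟩
  obtain ⟨η, hη, hη1, hη2⟩ : ∃ η : ℝ, 0 < η ∧ S + b 0 ^ 2 * (η * (2 / d + η)) < s ^ 2 ∧
      ((b 0 ^ 2 + b 0) / (1 - s) + b 0) * ((D + 1) * η) < (1 - s) * d := by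
    have h1 : ∀ᶠ η in nhds (0 : ℝ), S + b 0 ^ 2 * (η * (2 / d + η)) < s ^ 2 :=
      ContinuousAt.eventually_lt (by fun_prop) continuousAt_const (by simpa using hSs)
    have h2 : ∀ᶠ η in nhds (0 : ℝ),
        ((b 0 ^ 2 + b 0) / (1 - s) + b 0) * ((D + 1) * η) < (1 - s) * d :=
      ContinuousAt.eventually_lt (by fun_prop) continuousAt_const
        (by simpa using mul_pos (sub_pos.mpr hs1) hd0)
    obtain ⟨η, ⟨h3, h4⟩, h5⟩ := (((h1.and h2).filter_mono nhdsWithin_le_nhds).and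
      (self_mem_nhdsWithin (a := (0 : ℝ)) (s := Set.Ioi 0))).exists
    exact ⟨η, h5, h3, h4⟩
  obtain ⟨q, hq1, hq2, hq3⟩ := exists_polynomial_approx_inv_sub hμ hσ hd0 hd hD hη
  refine ⟨q.natDegree + 2, fun n hn => ?_⟩
  obtain ⟨m, rfl⟩ : ∃ m, n = m + 1 := ⟨n - 1, by omega⟩
  have hev := hlam (m + 1) (by omega)
  refine le_antisymm ?_ hev.1
  obtain ⟨g, hg1, hg2⟩ := hev.exists_resolvent_vector
  have hA : LinearMap.IsSymmetric (Matrix.toEuclideanLin (JacobiH1 a b (m + 1))) :=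
    Matrix.isSymmetric_toEuclideanLin_iff.mpr (isHermitian_jacobiH1 a b (m + 1))
  set A : Module.End ℂ (EuclideanSpace ℂ (Fin (m + 1))) :=
    Matrix.toEuclideanLin (JacobiH1 a b (m + 1)) with hAdef
  set e : EuclideanSpace ℂ (Fin (m + 1)) := EuclideanSpace.single 0 1 with he
  have hmom : ∀ k ≤ 2 * m + 1, inner ℂ e ((A ^ k) e) = ((∫ t, t ^ k ∂μ : ℝ) : ℂ) := by
    intro k hk
    rw [← hGauss (m + 1) (by omega) k (by omega), hAdef, he, toEuclideanLin_pow_single,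
      EuclideanSpace.inner_single_left]
    simp
  have hlow := mul_norm_le_norm_sub_of_cyclic hA hμ le_rfl hmom
    (exists_aeval_jacobiH1 a b hb m) hσ hd
  have hu : b 0 * ‖Polynomial.aeval A q e‖ ≤ s := by
    refine abs_le_of_sq_le_sq' ?_ hs0.le |>.2
    rw [mul_pow, norm_sq_aeval_eq_integral hA hμ hmom q (by omega)]
    have := mul_le_mul_of_nonneg_left hq2 (sq_nonneg (b 0))
    linarith
  have hr : ‖A (Polynomial.aeval A q e) - (x : ℂ) • Polynomial.aeval A q e - e‖
      ≤ (D + 1) * η := by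
    have h1 : A (Polynomial.aeval A q e) - (x : ℂ) • Polynomial.aeval A q e - e
        = Polynomial.aeval A ((Polynomial.X - Polynomial.C x) * q - 1) e := by
      simp [Module.algebraMap_end_apply]
    have hdeg : ((Polynomial.X - Polynomial.C x) * q - 1).natDegree ≤ q.natDegree + 1 := by
      refine (Polynomial.natDegree_sub_le_of_le (m := q.natDegree + 1) (n := 0) ?_ (by simp)).trans
        (by simp)
      refine Polynomial.natDegree_mul_le.trans ?_
      rw [Polynomial.natDegree_X_sub_C, add_comm]
    have h2 : ‖A (Polynomial.aeval A q e) - (x : ℂ) • Polynomial.aeval A q e - e‖ ≤ D * η := by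
      refine abs_le_of_sq_le_sq' ?_ (by positivity) |>.2
      rw [h1, norm_sq_aeval_eq_integral hA hμ hmom _ (by omega)]
      exact hq3
    linarith
  have hQ : inner ℂ (Polynomial.aeval A q e) e = ((∫ t, q.eval t ∂μ : ℝ) : ℂ) := by
    rw [hA.aeval_real q, inner_aeval_eq_integral hμ hmom q (by omega)]
  exact im_nonpos_of_approx_resolvent hA (hb 0) hd0 hs1 hg1 hg2 hr hQ hc
    (hq1.trans (by nlinarith)) hu hlow hη2
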